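/- Let α be a linearly ordered type whose strict order relation < is well-founded. Then there is no sequence (f_i)_{i∈ℕ} of antitone functions ℕ → α such that f_i ><sub>lex</sub> f_{i+1} for every i; that is, the lexicographic strict order is well-founded on the set of antitone functions ℕ → α. (This is the combinatorial core of the proof of Lemma 5.3: the sequences there are the non-increasing enumerations T_i^n of complexity sets, and the argument via N(i) and M(i) = min_{j≥i} N(j) proves exactly this statement.) -/

import Mathlib

/-- A function `ℕ → α` that is eventually non-increasing is eventually constant
when `<` is well-founded. -/
theorem WellFounded.exists_eventually_const_of_succ_le {α : Type*} [LinearOrder α]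
    (hwf : WellFounded ((· < ·) : α → α → Prop)) (u : ℕ → α) (I : ℕ)
    (hu : ∀ i ≥ I, u (i + 1) ≤ u i) : ∃ J ≥ I, ∀ i ≥ J, u i = u J := by
  obtain ⟨_, ⟨J, hJ, rfl⟩, hmin⟩ := hwf.has_min (u '' Set.Ici I) ⟨u I, I, Set.self_mem_Ici, rfl⟩
  refine ⟨J, hJ, fun i hi => le_antisymm ?_ (not_lt.1 (hmin _ ⟨i, le_trans hJ hi, rfl⟩))⟩
  induction i, hi using Nat.le_induction with
  | base => exact le_rfl
  | succ i hi ih => exact (hu i (le_trans hJ hi)).trans ih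

/-- In a lexicographically decreasing sequence of functions, every initial segment of
coordinates is eventually constant when `<` is well-founded. -/
theorem WellFounded.exists_eventually_const_initial_segment {α : Type*} [LinearOrder α]
    (hwf : WellFounded ((· < ·) : α → α → Prop)) (f : ℕ → ℕ → α) (N : ℕ → ℕ)
    (heq : ∀ i, ∀ n < N i, f i n = f (i + 1) n) (hlt : ∀ i, f (i + 1) (N i) < f i (N i))
    (k : ℕ) : ∃ I, ∀ i ≥ I, k ≤ N i ∧ ∀ n < k, f i n = f I n := by
  induction k with
  | zero => exact ⟨0, by simp⟩
  | succ k ih =>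
    obtain ⟨I, hI⟩ := ih
    obtain ⟨J, hJI, hJ⟩ := hwf.exists_eventually_const_of_succ_le (fun i => f i k) I (by
      intro i hi
      rcases (hI i hi).1.lt_or_eq with h | h
      · exact (heq i k h).ge
      · exact h ▸ (hlt i).le)
    refine ⟨J, fun i hi => ⟨?_, fun n hn => ?_⟩⟩
    · refine Nat.succ_le_of_lt ((hI i (le_trans hJI hi)).1.lt_of_ne fun h => ?_)
      have hi' : f (i + 1) k = f i k :=
        (hJ (i + 1) (Nat.le_succ_of_le hi)).trans (hJ i hi).symm
      have := hlt i
      rw [← h, hi'] at this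
      exact lt_irrefl _ this
    · rcases (Nat.lt_succ_iff.1 hn).lt_or_eq with h | rfl
      · exact ((hI i (le_trans hJI hi)).2 n h).trans ((hI J hJI).2 n h).symm
      · exact hJ i hi

/-- If `<` on a linearly ordered type `α` is well-founded, then there is no
sequence of antitone functions `ℕ → α` in which each function lexicographically exceeds
the next (i.e. the lexicographic strict order on antitone functions `ℕ → α` is
well-founded). Here `f >ₗₑₓ g` means: there is `N` with `f n = g n` for all `n < N`
and `f N > g N`. -/
theorem no_lex_descending_chain_of_antitone {α : Type*} [LinearOrder α]
    (hwf : WellFounded ((· < ·) : α → α → Prop)) :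
    ¬ ∃ f : ℕ → ℕ → α, (∀ i, Antitone (f i)) ∧
      (∀ i, ∃ N : ℕ, (∀ n < N, f i n = f (i + 1) n) ∧ f (i + 1) N < f i N) := by
  rintro ⟨f, hanti, hlex⟩
  choose N heq hlt using hlex
  choose I hI using hwf.exists_eventually_const_initial_segment f N heq hlt
  -- The pointwise limit of the sequence.
  let g : ℕ → α := fun n => f (I (n + 1)) n
  have hg : ∀ n, ∀ i ≥ I (n + 1), f i n = g n := fun n i hi =>
    (hI (n + 1) i hi).2 n n.lt_succ_self
  have hganti : ∀ n ≥ 0, g (n + 1) ≤ g n := fun n _ => by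
    rw [← hg n _ (le_max_left _ (I (n + 1 + 1))),
      ← hg (n + 1) _ (le_max_right (I (n + 1)) _)]
    exact hanti _ n.le_succ
  obtain ⟨m, -, hm⟩ := hwf.exists_eventually_const_of_succ_le g 0 hganti
  -- Past `I (m + 1)` every value at a coordinate `≥ m` is at most `g m`, so a coordinate
  -- that once drops below `g m` stays below it.
  have hle : ∀ i ≥ I (m + 1), ∀ n ≥ m, f i n ≤ g m := fun i hi n hn =>
    (hanti i hn).trans_eq (hg m i hi)
  have hN : ∀ i ≥ I (m + 1), m ≤ N i := fun i hi => m.le_succ.trans (hI (m + 1) i hi).1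
  set i₀ := I (m + 1)
  have hstay : ∀ j ≥ i₀ + 1, f j (N i₀) < g m := by
    intro j hj
    induction j, hj using Nat.le_induction with
    | base => exact (hlt i₀).trans_le (hle i₀ le_rfl _ (hN i₀ le_rfl))
    | succ j hj ih =>
      have hj' : j ≥ i₀ := (Nat.le_succ _).trans hj
      rcases lt_or_ge (N i₀) (N j) with h | h
      · exact heq j _ h ▸ ih
      · exact ((hanti _ h).trans_lt (hlt j)).trans_le (hle j hj' _ (hN j hj'))
  have hlast := hstay _ (le_max_left _ (I (N i₀ + 1)))
  rw [hg _ _ (le_max_right _ _), hm _ (hN i₀ le_rfl)] at hlast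
  exact lt_irrefl _ hlast
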